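/- Let a₁, a₂, a₃ be nonzero real numbers, c a real number, and let {·,·}_D be the Dirac bracket on ℝ³×ℝ³ associated with F₁ = x₁²/a₁ + x₂²/a₂ + x₃²/a₃ − 1 and F₂ = x₁p₁/a₁ + x₂p₂/a₂ + x₃p₃/a₃. Define the real functions H = (a₃p₃x₂ − a₂p₂x₃)²/(a₂a₃) + (a₁p₁x₃ − a₃p₃x₁)²/(a₁a₃) + 2(a₂p₂x₁ − a₁p₁x₂)²/(a₁a₂) + c x₁ and K = [(a₃p₃x₂ − a₂p₂x₃)²/(a₂a₃) − (a₁p₁x₃ − a₃p₃x₁)²/(a₁a₃) − c x₁]² + (1/(a₁a₂))·[2(a₃p₃x₂ − a₂p₂x₃)(a₁p₁x₃ − a₃p₃x₁)/a₃ − c a₁ x₂]². Then {H, K}_D = 0 at every point of the constraint surface (where F₁ = 0 and F₂ = 0). (These are the real integrals of the Kowalevsky system on the ellipsoid or hyperboloid, obtained after the coupling-constant transformation c → c√a₁.) -/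

import Mathlib

noncomputable section

/-- Phase space T*ℝ³ = ℝ³ × ℝ³ with coordinates (x, p). -/
abbrev Phase : Type := (Fin 3 → ℝ) × (Fin 3 → ℝ)

/-- Canonical Poisson bracket on ℝ³ × ℝ³:
{f,g} = Σᵢ (∂f/∂xᵢ ∂g/∂pᵢ − ∂f/∂pᵢ ∂g/∂xᵢ). -/
noncomputable def pb (f g : Phase → ℝ) (z : Phase) : ℝ :=
  ∑ i : Fin 3,
    (fderiv ℝ f z (Pi.single i 1, 0) * fderiv ℝ g z (0, Pi.single i 1) -
     fderiv ℝ f z (0, Pi.single i 1) * fderiv ℝ g z (Pi.single i 1, 0))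

/-- Dirac bracket associated with constraints F₁, F₂:
{f,g}_D = {f,g} − ({F₁,f}{F₂,g} − {F₁,g}{F₂,f})/{F₁,F₂}. -/
noncomputable def dirac (F₁ F₂ f g : Phase → ℝ) (z : Phase) : ℝ :=
  pb f g z - (pb F₁ f z * pb F₂ g z - pb F₁ g z * pb F₂ f z) / pb F₁ F₂ z
/-- Ellipsoid/hyperboloid constraint F₁ = x₁²/a₁ + x₂²/a₂ + x₃²/a₃ − 1. -/
noncomputable def ellF₁ (a₁ a₂ a₃ : ℝ) : Phase → ℝ := fun z =>
  z.1 0 ^ 2 / a₁ + z.1 1 ^ 2 / a₂ + z.1 2 ^ 2 / a₃ - 1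

/-- Ellipsoid/hyperboloid constraint F₂ = x₁p₁/a₁ + x₂p₂/a₂ + x₃p₃/a₃. -/
noncomputable def ellF₂ (a₁ a₂ a₃ : ℝ) : Phase → ℝ := fun z =>
  z.1 0 * z.2 0 / a₁ + z.1 1 * z.2 1 / a₂ + z.1 2 * z.2 2 / a₃

/-- Dirac bracket {·,·}_D on the ellipsoid/hyperboloid. -/
noncomputable def diracE (a₁ a₂ a₃ : ℝ) (f g : Phase → ℝ) (z : Phase) : ℝ :=
  dirac (ellF₁ a₁ a₂ a₃) (ellF₂ a₁ a₂ a₃) f g z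

/-- The Poisson bracket computed from given derivatives at a point. -/
lemma pb_eq_of_hasFDerivAt {f g : Phase → ℝ} {f' g' : Phase →L[ℝ] ℝ} {z : Phase}
    (hf : HasFDerivAt f f' z) (hg : HasFDerivAt g g' z) :
    pb f g z = ∑ i : Fin 3, (f' (Pi.single i 1, 0) * g' (0, Pi.single i 1) -
      f' (0, Pi.single i 1) * g' (Pi.single i 1, 0)) := by
  rw [pb, hf.fderiv, hg.fderiv]

/-- The position coordinate `xᵢ` as a continuous linear functional on phase space. -/
def positionCLM (i : Fin 3) : Phase →L[ℝ] ℝ :=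
  (ContinuousLinearMap.proj i).comp (ContinuousLinearMap.fst ℝ _ _)

/-- The momentum coordinate `pᵢ` as a continuous linear functional on phase space. -/
def momentumCLM (i : Fin 3) : Phase →L[ℝ] ℝ :=
  (ContinuousLinearMap.proj i).comp (ContinuousLinearMap.snd ℝ _ _)

@[simp] lemma positionCLM_apply (i : Fin 3) (w : Phase) : positionCLM i w = w.1 i := rfl

@[simp] lemma momentumCLM_apply (i : Fin 3) (w : Phase) : momentumCLM i w = w.2 i := rfl

lemma hasFDerivAt_position (i : Fin 3) (z : Phase) :
    HasFDerivAt (fun w : Phase => w.1 i) (positionCLM i) z :=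
  (positionCLM i).hasFDerivAt

lemma hasFDerivAt_momentum (i : Fin 3) (z : Phase) :
    HasFDerivAt (fun w : Phase => w.2 i) (momentumCLM i) z :=
  (momentumCLM i).hasFDerivAt

/-- A Dirac bracket of two functions that Poisson commute with the first constraint is their
canonical bracket. -/
lemma dirac_eq_pb {F₁ F₂ f g : Phase → ℝ} {z : Phase} (hf : pb F₁ f z = 0)
    (hg : pb F₁ g z = 0) : dirac F₁ F₂ f g z = pb f g z := by
  simp [dirac, hf, hg]

/-- Derivative of the weighted angular momentum component `b pⱼ xᵢ - a pᵢ xⱼ`. -/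
lemma hasFDerivAt_angular (a b : ℝ) (i j : Fin 3) (z : Phase) :
    HasFDerivAt (fun w : Phase => b * w.2 j * w.1 i - a * w.2 i * w.1 j)
      ((b * z.2 j) • positionCLM i + (z.1 i * b) • momentumCLM j -
        ((a * z.2 i) • positionCLM j + (z.1 j * a) • momentumCLM i)) z := by
  have h := (((hasFDerivAt_momentum j z).const_mul b).mul (hasFDerivAt_position i z)).sub
    (((hasFDerivAt_momentum i z).const_mul a).mul (hasFDerivAt_position j z))
  simp only [smul_smul] at h
  exact h

lemma hasFDerivAt_ellF₁ (a₁ a₂ a₃ : ℝ) (z : Phase) :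
    HasFDerivAt (ellF₁ a₁ a₂ a₃)
      ((2 * z.1 0 / a₁) • positionCLM 0 + (2 * z.1 1 / a₂) • positionCLM 1 +
        (2 * z.1 2 / a₃) • positionCLM 2) z := by
  have h := ((((hasFDerivAt_position 0 z).pow 2).mul_const a₁⁻¹).add
    (((hasFDerivAt_position 1 z).pow 2).mul_const a₂⁻¹)).add
    (((hasFDerivAt_position 2 z).pow 2).mul_const a₃⁻¹) |>.sub_const 1
  refine h.congr_fderiv (ContinuousLinearMap.ext fun w => ?_)
  simp
  ring

/-- real Kowalevsky integrals on the ellipsoid/hyperboloid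
(after the coupling-constant transformation c → c√a₁) are in involution with
respect to the Dirac bracket on the constraint surface. -/
theorem kowalevsky_ellipsoid_involution
    (a₁ a₂ a₃ : ℝ) (ha₁ : a₁ ≠ 0) (ha₂ : a₂ ≠ 0) (ha₃ : a₃ ≠ 0) (c : ℝ)
    (z : Phase)
    (h1 : ellF₁ a₁ a₂ a₃ z = 0) (h2 : ellF₂ a₁ a₂ a₃ z = 0) :
    diracE a₁ a₂ a₃
      (fun w => (a₃ * w.2 2 * w.1 1 - a₂ * w.2 1 * w.1 2) ^ 2 / (a₂ * a₃) +
        (a₁ * w.2 0 * w.1 2 - a₃ * w.2 2 * w.1 0) ^ 2 / (a₁ * a₃) +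
        2 * (a₂ * w.2 1 * w.1 0 - a₁ * w.2 0 * w.1 1) ^ 2 / (a₁ * a₂) +
        c * w.1 0)
      (fun w => ((a₃ * w.2 2 * w.1 1 - a₂ * w.2 1 * w.1 2) ^ 2 / (a₂ * a₃) -
          (a₁ * w.2 0 * w.1 2 - a₃ * w.2 2 * w.1 0) ^ 2 / (a₁ * a₃) -
          c * w.1 0) ^ 2 +
        (1 / (a₁ * a₂)) *
          (2 * (a₃ * w.2 2 * w.1 1 - a₂ * w.2 1 * w.1 2) *
            (a₁ * w.2 0 * w.1 2 - a₃ * w.2 2 * w.1 0) / a₃ -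
           c * a₁ * w.1 1) ^ 2) z = 0 := by
  have L₁ := hasFDerivAt_angular a₂ a₃ 1 2 z
  have L₂ := hasFDerivAt_angular a₃ a₁ 2 0 z
  have L₃ := hasFDerivAt_angular a₁ a₂ 0 1 z
  have hF := hasFDerivAt_ellF₁ a₁ a₂ a₃ z
  have hH := ((((L₁.pow 2).mul_const (a₂ * a₃)⁻¹).add ((L₂.pow 2).mul_const (a₁ * a₃)⁻¹)).add
    (((L₃.pow 2).const_mul 2).mul_const (a₁ * a₂)⁻¹)).add
    ((hasFDerivAt_position 0 z).const_mul c)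
  have hK := (((((L₁.pow 2).mul_const (a₂ * a₃)⁻¹).sub ((L₂.pow 2).mul_const (a₁ * a₃)⁻¹)).sub
    ((hasFDerivAt_position 0 z).const_mul c)).pow 2).add
    (((((L₁.const_mul 2).mul L₂).mul_const a₃⁻¹).sub
      ((hasFDerivAt_position 1 z).const_mul (c * a₁))).pow 2 |>.const_mul (1 / (a₁ * a₂)))
  rw [diracE, dirac_eq_pb]
  · refine (pb_eq_of_hasFDerivAt hH hK).trans ?_
    simp [Fin.sum_univ_three, Pi.single_apply]
    field_simp
    ring
  · refine (pb_eq_of_hasFDerivAt hF hH).trans ?_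
    simp [Fin.sum_univ_three, Pi.single_apply]
    field_simp
    ring
  · refine (pb_eq_of_hasFDerivAt hF hK).trans ?_
    simp [Fin.sum_univ_three, Pi.single_apply]
    field_simp
    ring
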